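/- Let w ∈ L and v ∈ ri(f|_K^{-1}(w)). If F is a face of K with v ∈ ri(F) and G is a face of L with w ∈ ri(G), then f(F) = G. -/

import Mathlib

open Set Filter Topology

/-- A face of a convex set `C`: a convex subset `F ⊆ C` such that any segment of `C` whose
relative interior meets `F` lies in `F` (i.e. `F` is convex and extreme in `C`). -/
def IsFaceOf {Y : Type*} [AddCommGroup Y] [Module ℝ Y] (C F : Set Y) : Prop :=
  Convex ℝ F ∧ IsExtreme ℝ C F

/-- A segment from a point of `s` to a point of the intrinsic interior of `s` can be prolonged
inside `s`. -/
theorem exists_mem_openSegment_of_mem_intrinsicInterior {E : Type*}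
    [NormedAddCommGroup E] [NormedSpace ℝ E] {s : Set E} {x y : E}
    (hx : x ∈ intrinsicInterior ℝ s) (hy : y ∈ s) : ∃ z ∈ s, x ∈ openSegment ℝ y z := by
  obtain ⟨x', hx', rfl⟩ := mem_intrinsicInterior.1 hx
  let p : ℝ → affineSpan ℝ s := fun t =>
    ⟨AffineMap.lineMap (x' : E) y (-t),
      AffineMap.lineMap_mem _ x'.2 (subset_affineSpan ℝ s hy)⟩
  have hp : Continuous p := by
    refine Continuous.subtype_mk ?_ _
    simp only [AffineMap.lineMap_apply_module]
    fun_prop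
  have hp0 : p 0 = x' := Subtype.ext (by simp [p])
  have hev : ∀ᶠ t in 𝓝 (0 : ℝ), p t ∈ interior ((↑) ⁻¹' s : Set (affineSpan ℝ s)) :=
    hp.continuousAt.eventually_mem (isOpen_interior.mem_nhds (hp0.symm ▸ hx'))
  obtain ⟨t, ht, ht0⟩ :=
    ((hev.filter_mono nhdsWithin_le_nhds).and self_mem_nhdsWithin :
      ∀ᶠ t in 𝓝[>] (0 : ℝ), _ ∧ t ∈ Ioi 0).exists
  have ht0 : 0 < t := ht0
  refine ⟨p t, interior_subset (s := ((↑) ⁻¹' s : Set (affineSpan ℝ s))) ht,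
    t / (1 + t), 1 / (1 + t), by positivity, by positivity,
    by field_simp; ring, ?_⟩
  simp only [p, AffineMap.lineMap_apply_module]
  match_scalars <;> field_simp <;> ring

theorem image_of_face_eq_face {X Y : Type*}
    [NormedAddCommGroup X] [NormedSpace ℝ X] [FiniteDimensional ℝ X]
    [NormedAddCommGroup Y] [NormedSpace ℝ Y] [FiniteDimensional ℝ Y]
    (K : Set X) (hKne : K.Nonempty) (hKcomp : IsCompact K) (hKconv : Convex ℝ K)
    (f : X →ₗ[ℝ] Y) (L : Set Y) (hL : L = f '' K)
    (w : Y) (hw : w ∈ L) (v : X)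
    (hv : v ∈ intrinsicInterior ℝ {x ∈ K | f x = w})
    (F : Set X) (hF : IsFaceOf K F) (hvF : v ∈ intrinsicInterior ℝ F)
    (G : Set Y) (hG : IsFaceOf L G) (hwG : w ∈ intrinsicInterior ℝ G) :
    f '' F = G := by
  subst hL
  have hwG' : w ∈ G := intrinsicInterior_subset hwG
  have hvF' : v ∈ F := intrinsicInterior_subset hvF
  have hfv : f v = w := (intrinsicInterior_subset hv).2
  apply Subset.antisymm
  · rintro _ ⟨y, hy, rfl⟩
    obtain ⟨z, hz, hvyz⟩ := exists_mem_openSegment_of_mem_intrinsicInterior hvF hy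
    refine hG.2.left_mem_of_mem_openSegment (mem_image_of_mem f (hF.2.subset hy))
      (mem_image_of_mem f (hF.2.subset hz)) hwG' ?_
    rw [← hfv]
    exact image_openSegment ℝ f.toAffineMap y z ▸ mem_image_of_mem f hvyz
  · intro g hg
    obtain ⟨g', hg', a, b, ha, hb, hab, hw'⟩ :=
      exists_mem_openSegment_of_mem_intrinsicInterior hwG hg
    obtain ⟨x, hx, rfl⟩ := hG.2.subset hg
    obtain ⟨x', hx', rfl⟩ := hG.2.subset hg'
    have hu : a • x + b • x' ∈ {x ∈ K | f x = w} :=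
      ⟨hKconv hx hx' ha.le hb.le hab, by simpa using hw'⟩
    obtain ⟨u', hu', hvu⟩ := exists_mem_openSegment_of_mem_intrinsicInterior hv hu
    have huF : a • x + b • x' ∈ F := hF.2.left_mem_of_mem_openSegment hu.1 hu'.1 hvF' hvu
    exact mem_image_of_mem f
      (hF.2.left_mem_of_mem_openSegment hx hx' huF ⟨a, b, ha, hb, hab, rfl⟩)
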